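/- arXiv:2507.12875 — 4 statements merged into one kernel-verified Lean document; each statement's English description precedes it below -/
import Mathlib

section
/- Let k ≥ 2, let f : (k+1)^V → ℝ be a nonnegative k-submodular function (not necessarily monotone) with f(0) = 0, let c be a cost function on V, and let B > 0 be a budget. Then every output s of the Greedy+Singleton algorithm with budget B (under arbitrary tie-breaking) satisfies c(s) ≤ B and 4·f(s) ≥ max{ f(x) : x ∈ (k+1)^V, c(x) ≤ B }. -/
open Finset

section KSubmodularDefs

variable {V : Type*} [Fintype V] [DecidableEq V] {k : ℕ}

/-- The support of a `k`-tuple `x : V → Fin (k+1)` (value `0` means "not selected"). -/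
def ksupp (x : V → Fin (k+1)) : Finset V := Finset.univ.filter fun e => x e ≠ 0

/-- The meet `x ⊓ y`. -/
def kinf (x y : V → Fin (k+1)) : V → Fin (k+1) :=
  fun e => if x e = y e then x e else 0

/-- The join `x ⊔ y`. -/
def ksup (x y : V → Fin (k+1)) : V → Fin (k+1) :=
  fun e => if y e = 0 ∨ y e = x e then x e else if x e = 0 then y e else 0

/-- `f` is `k`-submodular. -/
def KSubmodular (f : (V → Fin (k+1)) → ℝ) : Prop :=
  ∀ x y : V → Fin (k+1), f (ksup x y) + f (kinf x y) ≤ f x + f y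

/-- The partial order `x ⪯ y` on `(k+1)^V`. -/
def kle (x y : V → Fin (k+1)) : Prop := ∀ e : V, x e = 0 ∨ x e = y e

/-- `f` is monotone with respect to `⪯`. -/
def KMonotone (f : (V → Fin (k+1)) → ℝ) : Prop :=
  ∀ x y : V → Fin (k+1), kle x y → f x ≤ f y

/-- The marginal gain `Δ_{e,j}(x)` of assigning element `e` to component `j`. -/
def margin (f : (V → Fin (k+1)) → ℝ) (x : V → Fin (k+1)) (e : V) (j : Fin (k+1)) : ℝ :=
  f (Function.update x e j) - f x

/-- The total cost `c(x)` of a tuple. -/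
def kcost (c : V → ℝ) (x : V → Fin (k+1)) : ℝ := ∑ e ∈ ksupp x, c e

/-- One step of a greedy sequence relative to `o`: pick `e ∉ supp x` and `j ∈ {1,…,k}`
maximizing the marginal gain over components (a), and with marginal density at least that of
every pair `(e', j')` with `e' ∈ supp o \ supp x` (b). -/
def GreedyStep (f : (V → Fin (k+1)) → ℝ) (c : V → ℝ) (o : V → Fin (k+1))
    (x x' : V → Fin (k+1)) : Prop :=
  ∃ e : V, ∃ j : Fin (k+1), x e = 0 ∧ j ≠ 0 ∧ x' = Function.update x e j ∧
    (∀ j' : Fin (k+1), j' ≠ 0 → margin f x e j' ≤ margin f x e j) ∧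
    (∀ e' : V, o e' ≠ 0 → x e' = 0 → ∀ j' : Fin (k+1), j' ≠ 0 →
      margin f x e' j' * c e ≤ margin f x e j * c e')

/-- `GreedyRun f c B s V0 out`: starting from partial solution `s` with remaining elements `V0`,
the greedy procedure with budget `B` (under some tie-breaking) can terminate with output `out`.
At each step a pair `(e, j)` of maximum marginal density among remaining elements is chosen;
`e` is added (placed in component `j`) iff it fits in the remaining budget, and is removed
from the remaining pool in either case. -/
inductive GreedyRun (f : (V → Fin (k+1)) → ℝ) (c : V → ℝ) (B : ℝ) :
    (V → Fin (k+1)) → Finset V → (V → Fin (k+1)) → Prop where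
  | done (s : V → Fin (k+1)) : GreedyRun f c B s ∅ s
  | take (s : V → Fin (k+1)) (V0 : Finset V) (e : V) (j : Fin (k+1))
      (out : V → Fin (k+1)) (he : e ∈ V0) (hj : j ≠ 0)
      (hbest : ∀ e' ∈ V0, ∀ j' : Fin (k+1), j' ≠ 0 →
        margin f s e' j' / c e' ≤ margin f s e j / c e)
      (hfit : kcost c s + c e ≤ B)
      (hrest : GreedyRun f c B (Function.update s e j) (V0.erase e) out) :
      GreedyRun f c B s V0 out
  | skip (s : V → Fin (k+1)) (V0 : Finset V) (e : V) (j : Fin (k+1))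
      (out : V → Fin (k+1)) (he : e ∈ V0) (hj : j ≠ 0)
      (hbest : ∀ e' ∈ V0, ∀ j' : Fin (k+1), j' ≠ 0 →
        margin f s e' j' / c e' ≤ margin f s e j / c e)
      (hnofit : ¬ kcost c s + c e ≤ B)
      (hrest : GreedyRun f c B s (V0.erase e) out) :
      GreedyRun f c B s V0 out

/-- The `k`-multilinear extension of `f`, as a function of `x : V → Fin (k+1) → ℝ`
(only the coordinates `x e j` with `j ≠ 0` are relevant). -/
noncomputable def kext (f : (V → Fin (k+1)) → ℝ) (x : V → Fin (k+1) → ℝ) : ℝ :=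
  ∑ s : V → Fin (k+1), f s *
    ∏ e : V,
      (if s e = 0 then 1 - ∑ j ∈ Finset.univ.erase (0 : Fin (k+1)), x e j else x e (s e))

/-- The partial derivative of `F` with respect to the coordinate `(e, j)` at the point `x`. -/
noncomputable def pderiv (F : (V → Fin (k+1) → ℝ) → ℝ) (e : V) (j : Fin (k+1))
    (x : V → Fin (k+1) → ℝ) : ℝ :=
  deriv (fun t : ℝ => F (Function.update x e (Function.update (x e) j t))) (x e j)

/-- Membership in the domain `Δ_k^V` of the multilinear extension. -/
def inSimplex (x : V → Fin (k+1) → ℝ) : Prop :=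
  (∀ e : V, ∀ j : Fin (k+1), j ≠ 0 → 0 ≤ x e j ∧ x e j ≤ 1) ∧
  (∀ e : V, ∑ j ∈ Finset.univ.erase (0 : Fin (k+1)), x e j ≤ 1)

end KSubmodularDefs

section KSubmodularGreedy

variable {V : Type*} {k : ℕ}

/-- The tuple obtained from `o` by overriding it with `s` on the support of `s`. -/
def koverride (s o : V → Fin (k+1)) : V → Fin (k+1) := fun e => if s e = 0 then o e else s e

theorem kle_koverride (s o : V → Fin (k+1)) : kle s (koverride s o) := by
  intro e
  by_cases h : s e = 0 <;> simp [koverride, h]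

theorem exists_ne_zero_ne (hk : 2 ≤ k) (j : Fin (k+1)) : ∃ i : Fin (k+1), i ≠ 0 ∧ i ≠ j := by
  by_cases h : j = ⟨1, by omega⟩
  · refine ⟨⟨2, by omega⟩, ?_, ?_⟩ <;> simp [h, Fin.ext_iff]
  · refine ⟨⟨1, by omega⟩, ?_, Ne.symm h⟩
    simp [Fin.ext_iff]

theorem mem_ksupp [Fintype V] {x : V → Fin (k+1)} {e : V} : e ∈ ksupp x ↔ x e ≠ 0 := by
  simp [ksupp]

variable [DecidableEq V]

theorem koverride_update (s o : V → Fin (k+1)) (e : V) {j : Fin (k+1)} (hj : j ≠ 0) :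
    koverride (Function.update s e j) o = Function.update (koverride s o) e j := by
  funext a
  by_cases h : a = e
  · subst h; simp [koverride, hj]
  · simp [koverride, h]

/-- Orthant submodularity. -/
theorem KSubmodular.margin_anti {f : (V → Fin (k+1)) → ℝ} (hf : KSubmodular f)
    {x y : V → Fin (k+1)} (hxy : kle x y) {e : V} (hy : y e = 0) (j : Fin (k+1)) :
    margin f y e j ≤ margin f x e j := by
  have hx : x e = 0 := by rcases hxy e with h | h <;> simp [h, hy]
  have h := hf (Function.update x e j) y
  have hsup : ksup (Function.update x e j) y = Function.update y e j := by
    funext a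
    by_cases ha : a = e
    · subst ha; simp [ksup, hy]
    · rcases hxy a with h | h
      · by_cases hya : y a = 0 <;> simp [ksup, ha, h, hya]
      · simp [ksup, ha, h]
  have hinf : kinf (Function.update x e j) y = x := by
    funext a
    by_cases ha : a = e
    · subst ha; simp [kinf, hx, hy]
    · rcases hxy a with h | h <;> simp [kinf, ha, h]
  rw [hsup, hinf] at h
  unfold margin
  linarith

/-- Pairwise monotonicity. -/
theorem KSubmodular.margin_add_nonneg {f : (V → Fin (k+1)) → ℝ} (hf : KSubmodular f)
    {x : V → Fin (k+1)} {e : V} (hx : x e = 0) {i j : Fin (k+1)} (hi : i ≠ 0) (hj : j ≠ 0)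
    (hij : i ≠ j) : 0 ≤ margin f x e i + margin f x e j := by
  have h := hf (Function.update x e i) (Function.update x e j)
  have hsup : ksup (Function.update x e i) (Function.update x e j) = x := by
    funext a
    by_cases ha : a = e
    · subst ha; simp [ksup, hx, hi, hj, hij.symm]
    · simp [ksup, ha]
  have hinf : kinf (Function.update x e i) (Function.update x e j) = x := by
    funext a
    by_cases ha : a = e
    · subst ha; simp [kinf, hx, hij]
    · simp [kinf, ha]
  rw [hsup, hinf] at h
  unfold margin
  linarith

/-- If `j` is a best component for `e` at `s`, then adding `(e, j)` to a larger tuple loses at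
most the gain of `(e, j)` at `s`. -/
theorem KSubmodular.neg_margin_le {f : (V → Fin (k+1)) → ℝ} (hf : KSubmodular f) (hk : 2 ≤ k)
    {s w : V → Fin (k+1)} (hsw : kle s w) {e : V} (hw : w e = 0) {j : Fin (k+1)} (hj : j ≠ 0)
    (hbest : ∀ i : Fin (k+1), i ≠ 0 → margin f s e i ≤ margin f s e j) :
    -margin f w e j ≤ margin f s e j := by
  obtain ⟨i, hi, hij⟩ := exists_ne_zero_ne hk j
  linarith [hf.margin_add_nonneg hw hi hj hij, hf.margin_anti hsw hw i, hbest i hi]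

theorem KSubmodular.margin_nonneg_of_best {f : (V → Fin (k+1)) → ℝ} (hf : KSubmodular f)
    (hk : 2 ≤ k) {s : V → Fin (k+1)} {e : V} (hs : s e = 0) {j : Fin (k+1)} (hj : j ≠ 0)
    (hbest : ∀ i : Fin (k+1), i ≠ 0 → margin f s e i ≤ margin f s e j) :
    0 ≤ margin f s e j := by
  linarith [hf.neg_margin_le hk (fun _ => Or.inr rfl) hs hj hbest]

/-- Overriding `o` with a best choice for `e` loses at most twice the gain of that choice, and at
most once the gain if `e` is not in the support of `o`. -/
theorem KSubmodular.koverride_le {f : (V → Fin (k+1)) → ℝ} (hf : KSubmodular f) (hk : 2 ≤ k)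
    (s o : V → Fin (k+1)) {e : V} (hs : s e = 0) {j : Fin (k+1)} (hj : j ≠ 0)
    (hbest : ∀ i : Fin (k+1), i ≠ 0 → margin f s e i ≤ margin f s e j) :
    f (koverride s o) ≤ f (koverride (Function.update s e j) o)
      + (if o e = 0 then 1 else 2) * margin f s e j := by
  rw [koverride_update s o e hj]
  set w := Function.update (koverride s o) e 0 with hwdef
  have hwe : w e = 0 := by simp [w]
  have hsw : kle s w := by
    intro a
    by_cases ha : a = e
    · subst ha; exact Or.inl hs
    · simpa [w, ha] using kle_koverride s o a
  have hself : koverride s o = Function.update w e (o e) := by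
    funext a
    by_cases ha : a = e
    · subst ha; simp [koverride, hs]
    · simp [w, ha]
  have hnew : Function.update (koverride s o) e j = Function.update w e j := by simp [w]
  have hloss := hf.neg_margin_le hk hsw hwe hj hbest
  rw [hnew, hself]
  by_cases ho : o e = 0
  · have : Function.update w e (o e) = w := by rw [ho, ← hwe, Function.update_eq_self]
    rw [this, if_pos ho]
    unfold margin at *
    linarith
  · have h₁ := hf.margin_anti hsw hwe (o e)
    have h₂ := hbest (o e) ho
    rw [if_neg ho]
    unfold margin at *
    linarith

theorem KSubmodular.piecewise_le {f : (V → Fin (k+1)) → ℝ} (hf : KSubmodular f)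
    (s o : V → Fin (k+1)) (T : Finset V) (hT : ∀ e ∈ T, s e = 0) :
    f (T.piecewise o s) ≤ f s + ∑ e ∈ T, margin f s e (o e) := by
  induction T using Finset.induction_on with
  | empty => simp
  | insert e T he ih =>
    have hse : s e = 0 := hT e (mem_insert_self e T)
    have hT' : ∀ a ∈ T, s a = 0 := fun a ha => hT a (mem_insert_of_mem ha)
    have hle : kle s (T.piecewise o s) := by
      intro a
      by_cases ha : a ∈ T
      · exact Or.inl (hT' a ha)
      · simp [ha]
    have h := hf.margin_anti hle (e := e) (by simp [he, hse]) (o e)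
    have ih := ih hT'
    rw [sum_insert he, piecewise_insert]
    unfold margin at *
    linarith

variable [Fintype V]

theorem ksupp_update (x : V → Fin (k+1)) (e : V) {j : Fin (k+1)} (hj : j ≠ 0) :
    ksupp (Function.update x e j) = insert e (ksupp x) := by
  ext a
  by_cases h : a = e
  · subst h; simp [mem_ksupp, hj]
  · simp [mem_ksupp, h]

theorem kcost_update (c : V → ℝ) {x : V → Fin (k+1)} {e : V} (he : x e = 0)
    {j : Fin (k+1)} (hj : j ≠ 0) :
    kcost c (Function.update x e j) = kcost c x + c e := by
  rw [kcost, kcost, ksupp_update x e hj, sum_insert (by simp [mem_ksupp, he]), add_comm]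

theorem KSubmodular.koverride_le_sum {f : (V → Fin (k+1)) → ℝ} (hf : KSubmodular f)
    (s o : V → Fin (k+1)) :
    f (koverride s o) ≤ f s + ∑ e ∈ ksupp o \ ksupp s, margin f s e (o e) := by
  have h := hf.piecewise_le s o (ksupp o \ ksupp s) (by simp [mem_ksupp])
  have heq : (ksupp o \ ksupp s).piecewise o s = koverride s o := by
    funext a
    by_cases hs : s a = 0 <;> by_cases ho : o a = 0 <;>
      simp [Finset.piecewise, koverride, mem_ksupp, hs, ho]
  rwa [heq] at h

theorem GreedyRun.kcost_le {f : (V → Fin (k+1)) → ℝ} {c : V → ℝ} {B : ℝ}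
    {s : V → Fin (k+1)} {V0 : Finset V} {out : V → Fin (k+1)} (h : GreedyRun f c B s V0 out)
    (hV : ∀ e ∈ V0, s e = 0) (hs : kcost c s ≤ B) : kcost c out ≤ B := by
  induction h with
  | done s => exact hs
  | take s V0 e j out he hj hbest hfit hrest ih =>
    refine ih (fun a ha => ?_) ((kcost_update c (hV e he) hj).trans_le hfit)
    rw [Function.update_of_ne (ne_of_mem_erase ha)]
    exact hV a (mem_of_mem_erase ha)
  | skip s V0 e j out he hj hbest hnofit hrest ih =>
    exact ih (fun a ha => hV a (mem_of_mem_erase ha)) hs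

theorem GreedyRun.le_out {f : (V → Fin (k+1)) → ℝ} (hf : KSubmodular f) (hk : 2 ≤ k)
    {c : V → ℝ} (hc : ∀ e, 0 < c e) {B : ℝ}
    {s : V → Fin (k+1)} {V0 : Finset V} {out : V → Fin (k+1)} (h : GreedyRun f c B s V0 out)
    (hV : ∀ e ∈ V0, s e = 0) : f s ≤ f out := by
  induction h with
  | done s => exact le_rfl
  | take s V0 e j out he hj hbest hfit hrest ih =>
    have hm := hf.margin_nonneg_of_best hk (hV e he) hj
      fun i hi => (div_le_div_iff_of_pos_right (hc e)).1 (hbest e he i hi)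
    have ih := ih fun a ha => by
      rw [Function.update_of_ne (ne_of_mem_erase ha)]
      exact hV a (mem_of_mem_erase ha)
    unfold margin at hm
    linarith
  | skip s V0 e j out he hj hbest hnofit hrest ih =>
    exact ih fun a ha => hV a (mem_of_mem_erase ha)

/-- When an element of the support of `o` of best density does not fit, its gain and the gain `D`
collected outside the support of `o` pay for completing `s` by `o`. -/
theorem KSubmodular.koverride_le_of_not_fit {f : (V → Fin (k+1)) → ℝ} (hf : KSubmodular f)
    {c : V → ℝ} (hc : ∀ e, 0 < c e) {B : ℝ} {s o : V → Fin (k+1)} (ho : kcost c o ≤ B)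
    {e : V} {j : Fin (k+1)} (hm : 0 ≤ margin f s e j)
    (hbest : ∀ a ∈ ksupp o \ ksupp s, margin f s a (o a) / c a ≤ margin f s e j / c e)
    (hnofit : ¬ kcost c s + c e ≤ B) {D : ℝ}
    (hD : margin f s e j * ∑ a ∈ ksupp s \ ksupp o, c a ≤ D * c e) :
    f (koverride s o) ≤ f s + D + margin f s e j := by
  set ρ := margin f s e j / c e with hρ
  have hρ0 : 0 ≤ ρ := div_nonneg hm (hc e).le
  have hρe : ρ * c e = margin f s e j := div_mul_cancel₀ _ (hc e).ne'
  have hsum : ∑ a ∈ ksupp o \ ksupp s, margin f s a (o a)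
      ≤ ρ * ∑ a ∈ ksupp o \ ksupp s, c a := by
    rw [mul_sum]
    exact sum_le_sum fun a ha => (div_le_iff₀ (hc a)).1 (hbest a ha)
  have hcost : ∑ a ∈ ksupp o \ ksupp s, c a ≤ ∑ a ∈ ksupp s \ ksupp o, c a + c e := by
    have h₁ := sum_inter_add_sum_sdiff (ksupp o) (ksupp s) c
    have h₂ := sum_inter_add_sum_sdiff (ksupp s) (ksupp o) c
    rw [inter_comm] at h₂
    unfold kcost at ho hnofit
    linarith
  have hD' : ρ * ∑ a ∈ ksupp s \ ksupp o, c a ≤ D := by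
    rw [hρ, div_mul_eq_mul_div]
    exact (div_le_iff₀ (hc e)).2 hD
  have hmul := mul_le_mul_of_nonneg_left hcost hρ0
  rw [mul_add, hρe] at hmul
  linarith [hf.koverride_le_sum s o]

/-- The main induction: `D` is the gain collected so far outside the support of `o`. -/
theorem GreedyRun.le_three_mul_add {f : (V → Fin (k+1)) → ℝ} (hf : KSubmodular f) (hk : 2 ≤ k)
    {c : V → ℝ} (hc : ∀ e, 0 < c e) {B M : ℝ} (hM : 0 ≤ M) {o : V → Fin (k+1)}
    (ho : kcost c o ≤ B)
    (hsingle : ∀ e ∈ ksupp o, ∀ j : Fin (k+1), j ≠ 0 → margin f (fun _ => 0) e j ≤ M)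
    {s : V → Fin (k+1)} {V0 : Finset V} {out : V → Fin (k+1)} (h : GreedyRun f c B s V0 out)
    (hV : ∀ e ∈ V0, s e = 0) (hcover : ∀ e, o e ≠ 0 → s e = 0 → e ∈ V0)
    (D : ℝ) (hD0 : 0 ≤ D) (hval : f o ≤ f (koverride s o) + 2 * f s - D)
    (hD : ∀ e ∈ V0, ∀ j : Fin (k+1), j ≠ 0 →
      margin f s e j * ∑ a ∈ ksupp s \ ksupp o, c a ≤ D * c e) :
    f o ≤ 3 * f out + M := by
  induction h generalizing D with
  | done s =>
    have heq : koverride s o = s := by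
      funext a
      by_cases hs : s a = 0
      · have hoa : o a = 0 := by
          by_contra hoa
          simpa using hcover a hoa hs
        simp [koverride, hs, hoa]
      · simp [koverride, hs]
    rw [heq] at hval
    linarith
  | take s V0 e j out he hj hbest hfit hrest ih =>
    have hse := hV e he
    have hbest' : ∀ i : Fin (k+1), i ≠ 0 → margin f s e i ≤ margin f s e j :=
      fun i hi => (div_le_div_iff_of_pos_right (hc e)).1 (hbest e he i hi)
    have hm := hf.margin_nonneg_of_best hk hse hj hbest'
    have hover := hf.koverride_le hk s o hse hj hbest'
    have hfs : f (Function.update s e j) = f s + margin f s e j := by unfold margin; ring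
    have hV' : ∀ a ∈ V0.erase e, Function.update s e j a = 0 := fun a ha => by
      rw [Function.update_of_ne (ne_of_mem_erase ha)]
      exact hV a (mem_of_mem_erase ha)
    have hcover' : ∀ a, o a ≠ 0 → Function.update s e j a = 0 → a ∈ V0.erase e := by
      intro a hoa hsa
      have hae : a ≠ e := by
        rintro rfl
        exact hj (by simpa using hsa)
      rw [Function.update_of_ne hae] at hsa
      exact mem_erase.2 ⟨hae, hcover a hoa hsa⟩
    have hle : kle s (Function.update s e j) := by
      intro a
      by_cases ha : a = e
      · subst ha; exact Or.inl hse
      · simp [ha]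
    have hanti : ∀ a ∈ V0.erase e, ∀ i : Fin (k+1),
        margin f (Function.update s e j) a i ≤ margin f s a i :=
      fun a ha i => hf.margin_anti hle (hV' a ha) i
    have hS : 0 ≤ ∑ a ∈ ksupp s \ ksupp o, c a := sum_nonneg fun a _ => (hc a).le
    by_cases hoe : o e = 0
    · refine ih hV' hcover' (D + margin f s e j) (by linarith) ?_ ?_
      · rw [if_pos hoe] at hover
        rw [hfs]
        linarith
      · intro a ha i hi
        have hes : e ∉ ksupp s \ ksupp o := by simp [mem_ksupp, hse]
        rw [ksupp_update s e hj, insert_sdiff_of_notMem _ (by simp [mem_ksupp, hoe]),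
          sum_insert hes]
        have h₁ := mul_le_mul_of_nonneg_right (hanti a ha i) (add_nonneg (hc e).le hS)
        have h₂ := hD a (mem_of_mem_erase ha) i hi
        have h₃ := (div_le_div_iff₀ (hc a) (hc e)).1 (hbest a (mem_of_mem_erase ha) i hi)
        linarith
    · refine ih hV' hcover' D hD0 ?_ ?_
      · rw [if_neg hoe] at hover
        rw [hfs]
        linarith
      · intro a ha i hi
        rw [ksupp_update s e hj, insert_sdiff_of_mem _ (by simp [mem_ksupp, hoe])]
        exact (mul_le_mul_of_nonneg_right (hanti a ha i) hS).trans
          (hD a (mem_of_mem_erase ha) i hi)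
  | skip s V0 e j out he hj hbest hnofit hrest ih =>
    have hV' : ∀ a ∈ V0.erase e, s a = 0 := fun a ha => hV a (mem_of_mem_erase ha)
    by_cases hoe : o e = 0
    · refine ih hV' (fun a hoa hsa => mem_erase.2 ⟨?_, hcover a hoa hsa⟩) D hD0 hval
        fun a ha => hD a (mem_of_mem_erase ha)
      rintro rfl
      exact hoa hoe
    · have hse := hV e he
      have hm := hf.margin_nonneg_of_best hk hse hj
        fun i hi => (div_le_div_iff_of_pos_right (hc e)).1 (hbest e he i hi)
      have hfill := hf.koverride_le_of_not_fit hc ho hm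
        (fun a ha => by
          simp only [mem_sdiff, mem_ksupp, not_not] at ha
          exact hbest a (hcover a ha.1 ha.2) (o a) ha.1)
        hnofit (hD e he j hj)
      have hM' := (hf.margin_anti (x := fun _ => 0) (fun _ => Or.inl rfl) hse j).trans
        (hsingle e (mem_ksupp.2 hoe) j hj)
      have hout := hrest.le_out hf hk hc hV'
      linarith

end KSubmodularGreedy

/-- Greedy+Singleton is a `1/4`-approximation for (not necessarily monotone)
`k`-submodular maximization (`k ≥ 2`) under a knapsack constraint. -/
theorem greedy_plus_singleton_nonmonotone_quarter
    {V : Type*} [Fintype V] [DecidableEq V] {k : ℕ} (hk : 2 ≤ k)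
    (f : (V → Fin (k+1)) → ℝ)
    (hsub : KSubmodular f)
    (hnonneg : ∀ x : V → Fin (k+1), 0 ≤ f x) (hzero : f (fun _ => 0) = 0)
    (c : V → ℝ) (hc : ∀ e : V, 0 < c e) (B : ℝ) (hB : 0 < B)
    (g : V → Fin (k+1)) (hg : GreedyRun f c B (fun _ => 0) Finset.univ g)
    (s : V → Fin (k+1))
    (hform : s = g ∨ ((ksupp s).card = 1 ∧ kcost c s ≤ B))
    (hsg : f g ≤ f s)
    (hsy : ∀ y : V → Fin (k+1), (ksupp y).card = 1 → kcost c y ≤ B → f y ≤ f s) :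
    kcost c s ≤ B ∧ ∀ x : V → Fin (k+1), kcost c x ≤ B → f x ≤ 4 * f s := by
  have hg_cost : kcost c g ≤ B := hg.kcost_le (fun _ _ => rfl) (by simp [kcost, ksupp, hB.le])
  refine ⟨?_, fun x hx => ?_⟩
  · rcases hform with rfl | h
    · exact hg_cost
    · exact h.2
  have hsingle : ∀ e ∈ ksupp x, ∀ j : Fin (k+1), j ≠ 0 → margin f (fun _ => 0) e j ≤ f s := by
    intro e he j hj
    have hsupp : ksupp (Function.update (fun _ => 0) e j) = {e} := by
      rw [ksupp_update _ e hj]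
      simp [ksupp]
    have hfit : c e ≤ B := (single_le_sum (f := c) (fun a _ => (hc a).le) he).trans hx
    have h := hsy (Function.update (fun _ => 0) e j) (by simp [hsupp])
      (by simpa [kcost, hsupp] using hfit)
    simpa [margin, hzero] using h
  have hover : koverride (fun _ => 0) x = x := funext fun _ => if_pos rfl
  have h := hg.le_three_mul_add hsub hk hc (hnonneg s) hx hsingle (fun _ _ => rfl)
    (fun _ _ _ => mem_univ _) 0 le_rfl (by simp [hover, hzero]) (by simp [ksupp])
  linarith
end

section
/- A function f : (k+1)^V → ℝ is k-submodular if and only if it is both orthant submodular, i.e., Δ_{e,j}(x) ≥ Δ_{e,j}(y) for all x ⪯ y, every e ∉ supp(y) and every j ∈ {1,…,k}, and pairwise monotone, i.e., Δ_{e,j}(x) + Δ_{e,j'}(x) ≥ 0 for every x ∈ (k+1)^V, every e ∉ supp(x) and all distinct j, j' ∈ {1,…,k}. -/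
open Finset

section Piecewise

variable {V : Type*} [DecidableEq V] {k : ℕ} {f : (V → Fin (k+1)) → ℝ}

/-- Orthant submodularity for the simultaneous assignment of a set of elements. -/
theorem piecewise_sub_le_of_orthant
    (horth : ∀ x y : V → Fin (k+1), kle x y → ∀ e : V, y e = 0 →
      ∀ j : Fin (k+1), j ≠ 0 → margin f y e j ≤ margin f x e j)
    {x y : V → Fin (k+1)} (hxy : kle x y) (z : V → Fin (k+1)) (A : Finset V)
    (hA : ∀ e ∈ A, y e = 0) :
    f (A.piecewise z y) - f y ≤ f (A.piecewise z x) - f x := by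
  induction A using Finset.induction_on with
  | empty => simp
  | insert e B he ih =>
    have ih := ih fun a ha => hA a (mem_insert_of_mem ha)
    have hy : y e = 0 := hA e (mem_insert_self e B)
    have hx : x e = 0 := by have := hxy e; simp_all
    have hyB : B.piecewise z y e = 0 := by simp [he, hy]
    have hxB : B.piecewise z x e = 0 := by simp [he, hx]
    rw [piecewise_insert, piecewise_insert]
    by_cases hz : z e = 0
    · rw [hz, Function.update_eq_self_iff.2 hyB.symm, Function.update_eq_self_iff.2 hxB.symm]
      exact ih
    · have hle : kle (B.piecewise z x) (B.piecewise z y) := by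
        intro a
        by_cases ha : a ∈ B
        · simp [ha]
        · simpa [ha] using hxy a
      have h := horth _ _ hle e hyB (z e) hz
      simp only [margin] at h
      linarith

/-- Two assignments that conflict on every element of `A` gain at least `0` in total. -/
theorem two_mul_le_piecewise_add_piecewise
    (horth : ∀ x y : V → Fin (k+1), kle x y → ∀ e : V, y e = 0 →
      ∀ j : Fin (k+1), j ≠ 0 → margin f y e j ≤ margin f x e j)
    (hpair : ∀ x : V → Fin (k+1), ∀ e : V, x e = 0 →
      ∀ j j' : Fin (k+1), j ≠ 0 → j' ≠ 0 → j ≠ j' → 0 ≤ margin f x e j + margin f x e j')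
    (z w : V → Fin (k+1)) (A : Finset V)
    (hA : ∀ e ∈ A, z e ≠ 0 ∧ w e ≠ 0 ∧ z e ≠ w e)
    (u : V → Fin (k+1)) (hu : ∀ e ∈ A, u e = 0) :
    2 * f u ≤ f (A.piecewise z u) + f (A.piecewise w u) := by
  induction A using Finset.induction_on generalizing u with
  | empty => simp [two_mul]
  | insert e B he ih =>
    obtain ⟨hz, hw, hzw⟩ := hA e (mem_insert_self e B)
    have hue : u e = 0 := hu e (mem_insert_self e B)
    have huB : ∀ a ∈ B, Function.update u e (w e) a = 0 := fun a ha => by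
      rw [Function.update_of_ne (ne_of_mem_of_not_mem ha he)]
      exact hu a (mem_insert_of_mem ha)
    have ih := ih (fun a ha => hA a (mem_insert_of_mem ha)) (Function.update u e (w e)) huB
    have hzB : B.piecewise z u e = 0 := by simp [he, hue]
    have hpw := hpair (B.piecewise z u) e hzB (z e) (w e) hz hw hzw
    have hle : kle u (B.piecewise z u) := by
      intro a
      by_cases ha : a ∈ B
      · exact Or.inl (hu a (mem_insert_of_mem ha))
      · simp [ha]
    have hmarg := horth _ _ hle e hzB (w e) hw
    have hle' : kle u (Function.update u e (w e)) := by
      intro a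
      by_cases ha : a = e
      · subst ha; exact Or.inl hue
      · simp [ha]
    have hB := piecewise_sub_le_of_orthant horth hle' z B huB
    have hcomm : B.piecewise w (Function.update u e (w e)) =
        Function.update (B.piecewise w u) e (w e) :=
      (update_piecewise_of_notMem B w u he (w e)).symm
    rw [hcomm] at ih
    rw [piecewise_insert, piecewise_insert]
    simp only [margin] at hpw hmarg
    linarith

end Piecewise

/-- **Ward–Živný characterization.** `f` is `k`-submodular iff it is orthant
submodular and pairwise monotone. -/
theorem ksubmodular_iff_orthant_and_pairwise
    {V : Type*} [Fintype V] [DecidableEq V] {k : ℕ} (hk : 1 ≤ k)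
    (f : (V → Fin (k+1)) → ℝ) :
    KSubmodular f ↔
      ((∀ x y : V → Fin (k+1), kle x y → ∀ e : V, y e = 0 →
          ∀ j : Fin (k+1), j ≠ 0 → margin f y e j ≤ margin f x e j) ∧
       (∀ x : V → Fin (k+1), ∀ e : V, x e = 0 →
          ∀ j j' : Fin (k+1), j ≠ 0 → j' ≠ 0 → j ≠ j' →
            0 ≤ margin f x e j + margin f x e j')) := by
  constructor
  · intro hf
    refine ⟨fun x y hxy e hy j hj => ?_, fun x e hx j j' hj hj' hjj' => ?_⟩
    · have hsup : ksup (Function.update x e j) y = Function.update y e j := by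
        funext a
        have ha := hxy a
        by_cases hae : a = e
        · subst hae; simp [ksup, hy]
        · simp only [ksup, Function.update_of_ne hae]
          grind
      have hinf : kinf (Function.update x e j) y = x := by
        funext a
        have ha := hxy a
        by_cases hae : a = e
        · subst hae; simp_all [kinf]
        · simp only [kinf, Function.update_of_ne hae]
          grind
      have h := hf (Function.update x e j) y
      rw [hsup, hinf] at h
      simp only [margin]
      linarith
    · have hsup : ksup (Function.update x e j) (Function.update x e j') = x := by
        funext a
        by_cases hae : a = e
        · subst hae; simp [ksup, hx, hj, hj', hjj'.symm]
        · simp [ksup, hae]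
      have hinf : kinf (Function.update x e j) (Function.update x e j') = x := by
        funext a
        by_cases hae : a = e
        · subst hae; simp [kinf, hx, hjj']
        · simp [kinf, hae]
      have h := hf (Function.update x e j) (Function.update x e j')
      rw [hsup, hinf] at h
      simp only [margin]
      linarith
  · rintro ⟨horth, hpair⟩ x y
    set A : Finset V := univ.filter fun e => x e ≠ 0 ∧ y e ≠ 0 ∧ x e ≠ y e with hA
    set P : Finset V := univ.filter fun e => x e ≠ 0 ∧ y e = 0 with hP
    have hsupA : ∀ e ∈ A, ksup x y e = 0 := fun e he => by
      simp only [hA, mem_filter, mem_univ, true_and] at he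
      simp only [ksup]
      grind
    have hconf := two_mul_le_piecewise_add_piecewise horth hpair x y A
      (fun e he => by simpa [hA] using he) (ksup x y) hsupA
    have hx := piecewise_sub_le_of_orthant horth (x := A.piecewise 0 x) (y := ksup x y)
      (fun e => by
        simp only [hA, piecewise, mem_filter, mem_univ, true_and, ksup, Pi.zero_apply]
        grind) x A hsupA
    have hy := piecewise_sub_le_of_orthant horth (x := A.piecewise 0 y) (y := ksup x y)
      (fun e => by
        simp only [hA, piecewise, mem_filter, mem_univ, true_and, ksup, Pi.zero_apply]
        grind) y A hsupA
    have hxy := piecewise_sub_le_of_orthant horth (x := kinf x y) (y := A.piecewise 0 y)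
      (fun e => by
        simp only [hA, piecewise, mem_filter, mem_univ, true_and, kinf, Pi.zero_apply]
        grind) x P (fun e he => by
        simp only [hP, mem_filter, mem_univ, true_and] at he
        simp [hA, he.2])
    have hxA : A.piecewise x (A.piecewise 0 x) = x := by ext e; by_cases he : e ∈ A <;> simp [he]
    have hyA : A.piecewise y (A.piecewise 0 y) = y := by ext e; by_cases he : e ∈ A <;> simp [he]
    have hsup : P.piecewise x (A.piecewise 0 y) = ksup x y := by
      funext e
      simp only [hA, hP, piecewise, mem_filter, mem_univ, true_and, ksup, Pi.zero_apply]
      grind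
    have hinf : P.piecewise x (kinf x y) = A.piecewise (0 : V → Fin (k+1)) x := by
      funext e
      simp only [hA, hP, piecewise, mem_filter, mem_univ, true_and, kinf, Pi.zero_apply]
      grind
    rw [hxA] at hx
    rw [hyA] at hy
    rw [hsup, hinf] at hxy
    linarith
end

section
/- If f : (k+1)^V → ℝ is a monotone k-submodular function, then its k-multilinear extension F satisfies ∂F/∂x_{e,j}(x) ≥ 0 for every x ∈ Δ_k^V, every e ∈ V and every j ∈ {1,…,k}. -/
open Finset

/-- The weight that the fractional point `p` gives to the value `i` at a single element. -/
noncomputable def kweight {k : ℕ} (p : Fin (k+1) → ℝ) (i : Fin (k+1)) : ℝ :=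
  if i = 0 then 1 - ∑ j ∈ Finset.univ.erase (0 : Fin (k+1)), p j else p i

theorem hasDerivAt_kweight_update {k : ℕ} (p : Fin (k+1) → ℝ) {j : Fin (k+1)} (hj : j ≠ 0)
    (i : Fin (k+1)) (t : ℝ) :
    HasDerivAt (fun t : ℝ => kweight (Function.update p j t) i)
      ((if i = j then 1 else 0) - (if i = 0 then 1 else 0)) t := by
  by_cases hi : i = 0
  · subst hi
    have hmem : j ∈ Finset.univ.erase (0 : Fin (k+1)) := by simp [hj]
    simp only [kweight, if_true, if_neg hj.symm, Finset.sum_update_of_mem hmem]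
    simpa using ((hasDerivAt_id t).add_const _).const_sub 1
  · by_cases hij : i = j
    · subst hij
      simpa [kweight, hi] using hasDerivAt_id' t
    · simpa [kweight, hi, hij] using hasDerivAt_const t (p i)

theorem kweight_nonneg {V : Type*} {k : ℕ} {x : V → Fin (k+1) → ℝ} (hx : inSimplex x)
    (e : V) (i : Fin (k+1)) : 0 ≤ kweight (x e) i := by
  unfold kweight
  split_ifs with hi
  · exact sub_nonneg.2 (hx.2 e)
  · exact (hx.1 e i hi).1

theorem hasDerivAt_kext_update {V : Type*} [Fintype V] [DecidableEq V] {k : ℕ}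
    (f : (V → Fin (k+1)) → ℝ) (x : V → Fin (k+1) → ℝ) (e : V) {j : Fin (k+1)} (hj : j ≠ 0)
    (t : ℝ) :
    HasDerivAt (fun t : ℝ => kext f (Function.update x e (Function.update (x e) j t)))
      (∑ s : V → Fin (k+1), f s *
        (((if s e = j then 1 else 0) - (if s e = 0 then 1 else 0)) *
          ∏ a ∈ Finset.univ.erase e, kweight (x a) (s a))) t := by
  have hF : (fun t : ℝ => kext f (Function.update x e (Function.update (x e) j t))) =
      fun t => ∑ s : V → Fin (k+1), f s * (kweight (Function.update (x e) j t) (s e) *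
        ∏ a ∈ Finset.univ.erase e, kweight (x a) (s a)) := by
    funext t
    refine Finset.sum_congr rfl fun s _ => ?_
    change f s * ∏ a, kweight (Function.update x e (Function.update (x e) j t) a) (s a) = _
    rw [← Finset.mul_prod_erase _ _ (Finset.mem_univ e), Function.update_self]
    congr 2
    refine Finset.prod_congr rfl fun a ha => ?_
    rw [Function.update_of_ne (Finset.ne_of_mem_erase ha)]
  rw [hF]
  exact HasDerivAt.fun_sum fun s _ =>
    ((hasDerivAt_kweight_update (x e) hj (s e) t).mul_const _).const_mul _

theorem sum_filter_apply_eq {V M : Type*} [Fintype V] [DecidableEq V] [AddCommMonoid M] {k : ℕ}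
    (g : (V → Fin (k+1)) → M) (e : V) (j : Fin (k+1)) :
    ∑ s with s e = j, g s = ∑ s with s e = 0, g (Function.update s e j) := by
  refine Finset.sum_bij' (fun s _ => Function.update s e 0) (fun s _ => Function.update s e j)
    ?_ ?_ ?_ ?_ ?_ <;> intro s hs <;> simp_all [← (Finset.mem_filter.1 hs).2]

/-- If `f` is a monotone `k`-submodular function, its `k`-multilinear
extension `F` has nonnegative partial derivatives on `Δ_k^V`. -/
theorem kext_deriv_nonneg_of_monotone
    {V : Type*} [Fintype V] [DecidableEq V] {k : ℕ} (hk : 1 ≤ k)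
    (f : (V → Fin (k+1)) → ℝ) (hsub : KSubmodular f) (hmono : KMonotone f)
    (x : V → Fin (k+1) → ℝ) (hx : inSimplex x)
    (e : V) (j : Fin (k+1)) (hj : j ≠ 0) :
    0 ≤ pderiv (kext f) e j x := by
  unfold pderiv
  rw [(hasDerivAt_kext_update f x e hj (x e j)).deriv]
  simp only [sub_mul, mul_sub, Finset.sum_sub_distrib, ite_mul, one_mul, zero_mul, mul_ite,
    mul_zero, ← Finset.sum_filter]
  rw [sum_filter_apply_eq _ e j, sub_nonneg]
  refine Finset.sum_le_sum fun s hs => ?_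
  have hprod : ∏ a ∈ Finset.univ.erase e, kweight (x a) (Function.update s e j a) =
      ∏ a ∈ Finset.univ.erase e, kweight (x a) (s a) :=
    Finset.prod_congr rfl fun a ha => by
      rw [Function.update_of_ne (Finset.ne_of_mem_erase ha)]
  rw [hprod]
  refine mul_le_mul_of_nonneg_right (hmono _ _ fun a => ?_)
    (Finset.prod_nonneg fun a _ => kweight_nonneg hx a (s a))
  by_cases ha : a = e
  · exact Or.inl (ha ▸ (Finset.mem_filter.1 hs).2)
  · exact Or.inr (Function.update_of_ne ha _ _).symm
end

section
/- If f : (k+1)^V → ℝ is k-submodular, then its k-multilinear extension F has element-wise non-positive Hessian: for all distinct e, e' ∈ V, all j, j' ∈ {1,…,k} and every x ∈ Δ_k^V, ∂²F/∂x_{e,j}∂x_{e',j'}(x) ≤ 0. -/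
open Finset

/-- The probability that the product distribution with marginals `x` gives `e` the label `c`. -/
noncomputable def labelWeight {V : Type*} {k : ℕ} (x : V → Fin (k+1) → ℝ) (e : V)
    (c : Fin (k+1)) : ℝ :=
  if c = 0 then 1 - ∑ j ∈ Finset.univ.erase (0 : Fin (k+1)), x e j else x e c

section

variable {V : Type*} {k : ℕ}

theorem kext_eq_sum_labelWeight [Fintype V] [DecidableEq V]
    (f : (V → Fin (k+1)) → ℝ) (x : V → Fin (k+1) → ℝ) :
    kext f x = ∑ s : V → Fin (k+1), f s * ∏ e : V, labelWeight x e (s e) := rfl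

theorem sum_labelWeight (x : V → Fin (k+1) → ℝ) (e : V) :
    ∑ c, labelWeight x e c = 1 := by
  rw [← Finset.add_sum_erase _ _ (Finset.mem_univ (0 : Fin (k+1)))]
  have h : ∑ c ∈ Finset.univ.erase (0 : Fin (k+1)), labelWeight x e c
      = ∑ c ∈ Finset.univ.erase (0 : Fin (k+1)), x e c :=
    Finset.sum_congr rfl fun c hc => if_neg (Finset.ne_of_mem_erase hc)
  rw [h]
  simp [labelWeight]

theorem labelWeight_nonneg {x : V → Fin (k+1) → ℝ} (hx : inSimplex x) (e : V)
    (c : Fin (k+1)) : 0 ≤ labelWeight x e c := by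
  unfold labelWeight
  split_ifs with h
  · exact sub_nonneg.2 (hx.2 e)
  · exact (hx.1 e c h).1

theorem labelWeight_update_of_ne [DecidableEq V] (x : V → Fin (k+1) → ℝ) {e i : V} (h : i ≠ e)
    (v : Fin (k+1) → ℝ) (c : Fin (k+1)) :
    labelWeight (Function.update x e v) i c = labelWeight x i c := by
  simp [labelWeight, Function.update_of_ne h]

theorem labelWeight_update_self [DecidableEq V] (x : V → Fin (k+1) → ℝ) (e : V) {j : Fin (k+1)}
    (hj : j ≠ 0) (t : ℝ) (c : Fin (k+1)) :
    labelWeight (Function.update x e (Function.update (x e) j t)) e c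
      = labelWeight x e c
        + (t - x e j) * ((if c = j then 1 else 0) - (if c = 0 then 1 else 0)) := by
  unfold labelWeight
  by_cases hc : c = 0
  · have hmem : j ∈ Finset.univ.erase (0 : Fin (k+1)) := by simp [hj]
    simp only [hc, if_true, Function.update_self, Finset.sum_update_of_mem hmem,
      if_neg hj.symm]
    rw [← Finset.add_sum_erase _ (x e) hmem, Finset.sdiff_singleton_eq_erase]
    ring
  · by_cases hcj : c = j
    · subst hcj
      simp [hc]
    · simp [hc, hcj]

/-- Exchanging the label `s e` with the label `c`. -/
theorem sum_sum_update_swap [Fintype V] [DecidableEq V]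
    (e : V) (G : (V → Fin (k+1)) → Fin (k+1) → ℝ) :
    ∑ s, ∑ c, G (Function.update s e c) (s e) = ∑ s, ∑ c, G s c := by
  rw [← Fintype.sum_prod_type', ← Fintype.sum_prod_type']
  have hinv : Function.Involutive
      (fun p : (V → Fin (k+1)) × Fin (k+1) => (Function.update p.1 e p.2, p.1 e)) := by
    intro p
    simp
  exact hinv.bijective.sum_comp
    (fun p : (V → Fin (k+1)) × Fin (k+1) => G p.1 p.2)

/-- Expanding the extension of a discrete difference of `f`. -/
theorem kext_update_sub_update [Fintype V] [DecidableEq V]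
    (f : (V → Fin (k+1)) → ℝ) (e : V) (j : Fin (k+1))
    (x : V → Fin (k+1) → ℝ) :
    kext (fun s => f (Function.update s e j) - f (Function.update s e 0)) x
      = ∑ s : V → Fin (k+1), f s * (((if s e = j then 1 else 0) - (if s e = 0 then 1 else 0))
          * ∏ i ∈ Finset.univ.erase e, labelWeight x i (s i)) := by
  have hswap := sum_sum_update_swap e (fun s c =>
    f s * ((((if s e = j then 1 else 0) - (if s e = 0 then 1 else 0)) : ℝ)
      * ∏ i ∈ Finset.univ.erase e, labelWeight x i (s i)) * labelWeight x e c)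
  simp only [← Finset.mul_sum, sum_labelWeight, mul_one] at hswap
  rw [← hswap, kext_eq_sum_labelWeight]
  refine Finset.sum_congr rfl fun s _ => ?_
  have hprod (c : Fin (k+1)) :
      ∏ i ∈ Finset.univ.erase e, labelWeight x i (Function.update s e c i)
        = ∏ i ∈ Finset.univ.erase e, labelWeight x i (s i) :=
    Finset.prod_congr rfl fun i hi => by
      rw [Function.update_of_ne (Finset.ne_of_mem_erase hi)]
  simp only [hprod, Function.update_self]
  rw [← Finset.mul_prod_erase _ _ (Finset.mem_univ e)]
  simp only [sub_mul, mul_sub, Finset.sum_sub_distrib, ite_mul, mul_ite, one_mul, zero_mul,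
    mul_zero, Finset.sum_ite_eq', Finset.mem_univ, if_true]
  ring

/-- The extension is affine in each coordinate. -/
theorem kext_update [Fintype V] [DecidableEq V]
    (f : (V → Fin (k+1)) → ℝ) (e : V) {j : Fin (k+1)} (hj : j ≠ 0)
    (x : V → Fin (k+1) → ℝ) (t : ℝ) :
    kext f (Function.update x e (Function.update (x e) j t))
      = kext f x + (t - x e j)
        * kext (fun s => f (Function.update s e j) - f (Function.update s e 0)) x := by
  rw [kext_update_sub_update, kext_eq_sum_labelWeight, kext_eq_sum_labelWeight,
    Finset.mul_sum, ← Finset.sum_add_distrib]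
  refine Finset.sum_congr rfl fun s _ => ?_
  rw [← Finset.mul_prod_erase _ _ (Finset.mem_univ e),
    ← Finset.mul_prod_erase _ (fun i => labelWeight x i (s i)) (Finset.mem_univ e),
    labelWeight_update_self x e hj,
    Finset.prod_congr rfl fun i hi =>
      labelWeight_update_of_ne x (Finset.ne_of_mem_erase hi) _ (s i)]
  ring

/-- Partial derivatives of the extension are extensions of discrete differences. -/
theorem pderiv_kext [Fintype V] [DecidableEq V]
    (f : (V → Fin (k+1)) → ℝ) (e : V) {j : Fin (k+1)} (hj : j ≠ 0) :
    pderiv (kext f) e j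
      = kext (fun s => f (Function.update s e j) - f (Function.update s e 0)) := by
  funext x
  simp only [pderiv, kext_update f e hj x]
  exact HasDerivAt.deriv <| by
    simpa using (((hasDerivAt_id (x e j)).sub_const (x e j)).mul_const
      (kext (fun s => f (Function.update s e j) - f (Function.update s e 0)) x)).const_add
      (kext f x)

theorem kext_nonpos [Fintype V] [DecidableEq V] {g : (V → Fin (k+1)) → ℝ} (hg : ∀ s, g s ≤ 0)
    {x : V → Fin (k+1) → ℝ} (hx : inSimplex x) : kext g x ≤ 0 :=
  Finset.sum_nonpos fun s _ => mul_nonpos_of_nonpos_of_nonneg (hg s)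
    (Finset.prod_nonneg fun e _ => labelWeight_nonneg hx e (s e))

/-- Submodularity on the square spanned by assigning `e ↦ j` and `e' ↦ j'`. -/
theorem KSubmodular.update_update_le [DecidableEq V]
    {f : (V → Fin (k+1)) → ℝ} (hsub : KSubmodular f)
    (e e' : V) {j j' : Fin (k+1)} (hj : j ≠ 0) (hj' : j' ≠ 0)
    (s : V → Fin (k+1)) :
    f (Function.update (Function.update s e' j') e j)
        + f (Function.update (Function.update s e' 0) e 0)
      ≤ f (Function.update (Function.update s e' 0) e j)
        + f (Function.update (Function.update s e' j') e 0) := by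
  convert hsub (Function.update (Function.update s e' 0) e j)
    (Function.update (Function.update s e' j') e 0) using 3
  · funext i
    simp only [ksup, Function.update_apply]
    grind
  · funext i
    simp only [kinf, Function.update_apply]
    grind

end

/-- If `f` is `k`-submodular, its `k`-multilinear extension has element-wise
non-positive Hessian: mixed second partials across distinct elements are `≤ 0` on `Δ_k^V`. -/
theorem kext_hessian_nonpos
    {V : Type*} [Fintype V] [DecidableEq V] {k : ℕ} (hk : 1 ≤ k)
    (f : (V → Fin (k+1)) → ℝ) (hsub : KSubmodular f)
    (e e' : V) (hee : e ≠ e') (j j' : Fin (k+1)) (hj : j ≠ 0) (hj' : j' ≠ 0)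
    (x : V → Fin (k+1) → ℝ) (hx : inSimplex x) :
    pderiv (pderiv (kext f) e j) e' j' x ≤ 0 := by
  rw [pderiv_kext f e hj, pderiv_kext _ e' hj']
  refine kext_nonpos (fun s => ?_) hx
  linarith [hsub.update_update_le e e' hj hj' s]
end
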